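/- arXiv:1409.4966 — 14 statements merged into one kernel-verified Lean document; each statement's English description precedes it below -/
import Mathlib

section
/- Let d ≥ 1, let a : Fin d → ℕ be a Golomb ruler, and let n be a natural number with n > 2 * (a of the last index). Then for all x, y : ZMod n with x ≠ y, the two sets {x + (a i : ZMod n) : i : Fin d} and {y + (a i : ZMod n) : i : Fin d} intersect in at most one element; that is, if p and q both belong to both sets, then p = q. -/
/-- `a : Fin d → ℕ` is a Golomb ruler: strictly monotone and all pairwise
differences are distinct in the sense of the stated implication. -/
def IsGolombRuler {d : ℕ} (a : Fin d → ℕ) : Prop :=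
  StrictMono a ∧
    ∀ i j i' j' : Fin d, (a j : ℤ) - (a i : ℤ) = (a j' : ℤ) - (a i' : ℤ) → i = j ∨ j = j'

theorem stmt_0 {d : ℕ} (hd : 1 ≤ d) (a : Fin d → ℕ) (ha : IsGolombRuler a)
    (n : ℕ) (hn : n > 2 * a ⟨d - 1, by omega⟩)
    (x y : ZMod n) (hxy : x ≠ y) (p q : ZMod n)
    (hpx : ∃ i : Fin d, p = x + (a i : ZMod n))
    (hpy : ∃ i : Fin d, p = y + (a i : ZMod n))
    (hqx : ∃ i : Fin d, q = x + (a i : ZMod n))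
    (hqy : ∃ i : Fin d, q = y + (a i : ZMod n)) :
    p = q := by
  obtain ⟨i, rfl⟩ := hpx
  obtain ⟨j, hj⟩ := hpy
  obtain ⟨k, rfl⟩ := hqx
  obtain ⟨l, hl⟩ := hqy
  have hlt : ∀ i, 2 * a i < n := fun i =>
    lt_of_le_of_lt (Nat.mul_le_mul_left 2 <| ha.1.monotone <|
      Fin.le_def.mpr (Nat.le_sub_one_of_lt i.isLt)) hn
  have hmod : ((a i + a l : ℕ) : ZMod n) = ((a j + a k : ℕ) : ZMod n) := by
    push_cast
    linear_combination hj - hl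
  have hsum : a i + a l = a j + a k := by
    refine Nat.ModEq.eq_of_lt_of_lt ((ZMod.natCast_eq_natCast_iff _ _ _).mp hmod) ?_ ?_
    · linarith [hlt i, hlt l]
    · linarith [hlt j, hlt k]
  rcases ha.2 j i l k (by omega) with rfl | rfl
  · exact absurd (add_right_cancel hj) hxy
  · rfl
end

section
/- Let d ≥ 1, let a : Fin d → ℕ be a Golomb ruler, let n be a natural number with n > 2 * (a of the last index), and let K be a finite simplicial complex on vertex set Fin d. Then every face τ of K̃ with |τ| ≥ 2 is contained in the set Ṽ_x = {x + (a i : ZMod n) : i : Fin d} for exactly one x : ZMod n. -/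
/-- For a Golomb ruler with marks bounded by `m` and `2 * m < n`, congruent differences modulo `n`
are equal as integers, so two distinct points lie in at most one translate of the ruler. -/
theorem IsGolombRuler.translate_unique {d : ℕ} {a : Fin d → ℕ} (ha : IsGolombRuler a)
    {m n : ℕ} (hm : ∀ i, a i ≤ m) (hn : 2 * m < n) {x y : ZMod n} {p q i j : Fin d}
    (hpq : p ≠ q) (hp : x + (a p : ZMod n) = y + (a i : ZMod n))
    (hq : x + (a q : ZMod n) = y + (a j : ZMod n)) : x = y := by
  have hmod : ((((a q : ℤ) - a p) - ((a j : ℤ) - a i) : ℤ) : ZMod n) = 0 := by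
    push_cast
    linear_combination hq - hp
  have hzero : ((a q : ℤ) - a p) - ((a j : ℤ) - a i) = 0 := by
    refine Int.eq_zero_of_abs_lt_dvd ((ZMod.intCast_zmod_eq_zero_iff_dvd _ n).1 hmod) ?_
    have h₁ := hm p
    have h₂ := hm q
    have h₃ := hm i
    have h₄ := hm j
    rw [abs_lt]
    constructor <;> omega
  rcases ha.2 p q i j (sub_eq_zero.1 hzero) with h | rfl
  · exact absurd h hpq
  · exact add_right_cancel hq

theorem stmt_1 {d : ℕ} (hd : 1 ≤ d) (a : Fin d → ℕ) (ha : IsGolombRuler a)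
    (n : ℕ) (hn : n > 2 * a ⟨d - 1, by omega⟩)
    -- `K` is a finite simplicial complex on vertex set `Fin d`
    (K : Set (Finset (Fin d)))
    (hKne : ∀ σ ∈ K, σ.Nonempty)
    (hKdown : ∀ σ ∈ K, ∀ τ ⊆ σ, τ.Nonempty → τ ∈ K)
    (hKsing : ∀ v : Fin d, {v} ∈ K)
    -- `τ` is a face of `K̃` of cardinality at least 2
    (τ : Finset (ZMod n))
    (hτ : ∃ (x : ZMod n) (σ : Finset (Fin d)), σ ∈ K ∧
      τ = σ.image (fun i => x + (a i : ZMod n)))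
    (hcard : 2 ≤ τ.card) :
    -- `τ` is contained in `Ṽ_x` for exactly one `x`
    ∃! x : ZMod n, ∀ v ∈ τ, ∃ i : Fin d, v = x + (a i : ZMod n) := by
  obtain ⟨x, σ, -, rfl⟩ := hτ
  obtain ⟨u, hu, v, hv, huv⟩ := Finset.one_lt_card.1 hcard
  obtain ⟨p, -, rfl⟩ := Finset.mem_image.1 hu
  obtain ⟨q, -, rfl⟩ := Finset.mem_image.1 hv
  refine ⟨x, fun w hw => ?_, fun y hy => ?_⟩
  · obtain ⟨i, -, rfl⟩ := Finset.mem_image.1 hw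
    exact ⟨i, rfl⟩
  · obtain ⟨i, hi⟩ := hy _ hu
    obtain ⟨j, hj⟩ := hy _ hv
    have hle (k : Fin d) : a k ≤ a ⟨d - 1, by omega⟩ :=
      ha.1.monotone (Fin.le_def.2 (Nat.le_sub_one_of_lt k.isLt))
    exact (ha.translate_unique hle hn (fun h => huv (by rw [h])) hi hj).symm
end

section
/- Let d ≥ 1, let a : Fin d → ℕ be a Golomb ruler, let n be a natural number with n > 2 * (a of the last index), and let K be a finite simplicial complex on vertex set Fin d. Then for every x : ZMod n the map i ↦ x + (a i : ZMod n) is injective on Fin d, and for every subset σ ⊆ Fin d with |σ| ≥ 2, the image {x + (a i : ZMod n) : i ∈ σ} is a face of K̃ if and only if σ ∈ K. -/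
namespace IsGolombRuler

variable {d n : ℕ} {a : Fin d → ℕ}

/-- Congruent differences of marks of a ruler of length less than `n / 2` are equal. -/
theorem sub_eq_sub_of_cast (h : ∀ i, 2 * a i < n) {i j i' j' : Fin d}
    (e : (a j : ZMod n) - a i = a j' - a i') :
    (a j : ℤ) - (a i : ℤ) = (a j' : ℤ) - (a i' : ℤ) := by
  have e' : (((a j : ℤ) - a i - (a j' - a i') : ℤ) : ZMod n) = 0 := by
    push_cast
    exact sub_eq_zero.mpr e
  have hdvd := (ZMod.intCast_zmod_eq_zero_iff_dvd _ n).mp e'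
  have habs : |(a j : ℤ) - a i - (a j' - a i')| < n := by
    have := h i
    have := h j
    have := h i'
    have := h j'
    rw [abs_lt]
    omega
  exact sub_eq_zero.mp (Int.eq_zero_of_abs_lt_dvd hdvd habs)

theorem injective_add_cast (ha : IsGolombRuler a) (h : ∀ i, 2 * a i < n) (x : ZMod n) :
    Function.Injective fun i : Fin d => x + (a i : ZMod n) := by
  intro i j e
  have e' : (a j : ZMod n) - a i = a i - a i := by
    rw [add_left_cancel e]
  have := sub_eq_sub_of_cast h e'
  exact ha.1.injective (by omega)

/-- Two translates of the ruler that share two points coincide. -/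
theorem eq_of_image_eq (ha : IsGolombRuler a) (h : ∀ i, 2 * a i < n) {x y : ZMod n}
    {σ ρ : Finset (Fin d)} (hσ : 2 ≤ σ.card)
    (e : σ.image (fun i => x + (a i : ZMod n)) = ρ.image (fun i => y + (a i : ZMod n))) :
    x = y ∧ σ = ρ := by
  have hmem : ∀ i ∈ σ, ∃ i' ∈ ρ, y + (a i' : ZMod n) = x + (a i : ZMod n) := fun i hi =>
    Finset.mem_image.mp (e ▸ Finset.mem_image_of_mem _ hi)
  obtain ⟨i, hi, j, hj, hij⟩ := Finset.one_lt_card.mp hσ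
  obtain ⟨i', -, ei⟩ := hmem i hi
  obtain ⟨j', -, ej⟩ := hmem j hj
  have hxy : x = y := by
    obtain rfl | rfl := ha.2 i j i' j' (sub_eq_sub_of_cast h (by linear_combination ei - ej))
    · exact absurd rfl hij
    · exact (add_right_cancel ej).symm
  subst hxy
  exact ⟨rfl, Finset.image_injective (ha.injective_add_cast h x) e⟩

end IsGolombRuler

theorem stmt_2 {d : ℕ} (hd : 1 ≤ d) (a : Fin d → ℕ) (ha : IsGolombRuler a)
    (n : ℕ) (hn : n > 2 * a ⟨d - 1, by omega⟩)
    -- `K` is a finite simplicial complex on vertex set `Fin d`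
    (K : Set (Finset (Fin d)))
    (hKne : ∀ σ ∈ K, σ.Nonempty)
    (hKdown : ∀ σ ∈ K, ∀ τ ⊆ σ, τ.Nonempty → τ ∈ K)
    (hKsing : ∀ v : Fin d, {v} ∈ K) :
    -- for each `x` the map `i ↦ x + a i` is injective
    (∀ x : ZMod n, Function.Injective fun i : Fin d => x + (a i : ZMod n)) ∧
    -- for `|σ| ≥ 2`, the image of `σ` is a face of `K̃` iff `σ ∈ K`
    (∀ (x : ZMod n) (σ : Finset (Fin d)), 2 ≤ σ.card →
      ((∃ (y : ZMod n) (ρ : Finset (Fin d)), ρ ∈ K ∧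
          σ.image (fun i => x + (a i : ZMod n)) = ρ.image (fun i => y + (a i : ZMod n)))
        ↔ σ ∈ K)) := by 
  have h : ∀ i, 2 * a i < n := fun i => by
    have := ha.1.monotone (show i ≤ ⟨d - 1, by omega⟩ from Fin.le_def.mpr (by simp; omega))
    omega
  refine ⟨ha.injective_add_cast h, fun x σ hσ => ⟨?_, fun hK => ⟨x, σ, hK, rfl⟩⟩⟩
  rintro ⟨y, ρ, hρ, e⟩
  exact (ha.eq_of_image_eq h hσ e).2 ▸ hρ
end

section
/- Let d ≥ 2, let H be a connected simple graph on Fin d, let a : Fin d → ℕ be strictly monotone, and let n ≥ 2 be a natural number such that n is coprime to (a j : ℤ) − (a i : ℤ) for all i < j. Define the simple graph G̃ on ZMod n in which u and v are adjacent iff u ≠ v and there exist x : ZMod n and i, j : Fin d with H.Adj i j, u = x + (a i : ZMod n) and v = x + (a j : ZMod n). Then G̃ is connected. -/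
/-- A graph on `ZMod n` in which every vertex is joined to its translate by a fixed unit is
connected. -/
theorem SimpleGraph.connected_of_reachable_add_isUnit {n : ℕ} [NeZero n]
    {G : SimpleGraph (ZMod n)} {c : ZMod n} (hc : IsUnit c)
    (h : ∀ x, G.Reachable x (x + c)) : G.Connected := by
  have hmul (x : ZMod n) (k : ℕ) : G.Reachable x (x + k * c) := by
    induction k with
    | zero => simp
    | succ k ih =>
      have hk := ih.trans (h _)
      rwa [add_assoc, ← add_one_mul, ← Nat.cast_succ] at hk
  refine ⟨fun u v => ?_⟩
  obtain ⟨b, hb⟩ := hc.exists_left_inv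
  have huv := hmul u ((v - u) * b).val
  rwa [ZMod.natCast_zmod_val, mul_assoc, hb, mul_one, add_sub_cancel] at huv

theorem stmt_4 {d : ℕ} (hd : 2 ≤ d) (H : SimpleGraph (Fin d)) (hH : H.Connected)
    (a : Fin d → ℕ) (hmono : StrictMono a)
    (n : ℕ) (hn : 2 ≤ n)
    (hcop : ∀ i j : Fin d, i < j → Int.gcd (n : ℤ) ((a j : ℤ) - (a i : ℤ)) = 1)
    (G : SimpleGraph (ZMod n))
    (hG : ∀ u v : ZMod n, G.Adj u v ↔ u ≠ v ∧ ∃ (x : ZMod n) (i j : Fin d),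
      H.Adj i j ∧ u = x + (a i : ZMod n) ∧ v = x + (a j : ZMod n)) :
    G.Connected := by
  have : NeZero n := ⟨by omega⟩
  have : Nontrivial (Fin d) := Fin.nontrivial_iff_two_le.2 hd
  obtain ⟨i, j, hij, hadj⟩ : ∃ i j, i < j ∧ H.Adj i j := by
    obtain ⟨j, hj⟩ := hH.preconnected.exists_adj_of_nontrivial ⟨0, by omega⟩
    rcases hj.ne.lt_or_gt with hlt | hlt
    exacts [⟨_, _, hlt, hj⟩, ⟨_, _, hlt, hj.symm⟩]
  have hc : IsUnit (((a j : ℤ) - (a i : ℤ) : ℤ) : ZMod n) :=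
    (ZMod.coe_int_isUnit_iff_isCoprime _ _).2 (Int.isCoprime_iff_gcd_eq_one.2 (hcop i j hij))
  refine SimpleGraph.connected_of_reachable_add_isUnit hc fun x => ?_
  by_cases hx : x = x + (((a j : ℤ) - (a i : ℤ) : ℤ) : ZMod n)
  · rw [← hx]
  · refine ((hG _ _).2 ⟨hx, x - a i, i, j, hadj, by ring, ?_⟩).reachable
    push_cast
    ring
end

section
/- Let G be a simple graph on a finite vertex type V which is a cluster with parts (V i)_{i : ι}, and suppose the cluster has cluster-girth at least 4 (there is no cycle of length 3 in the sense of the cluster-girth definition). Then every nonempty clique of G (every nonempty finite set of vertices that are pairwise adjacent) is contained in V i for some i : ι. -/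
/-- The family of parts `P` has cluster-girth at least `g`: there is no cycle
`v 0, P (idx 0), v 1, P (idx 1), …, v (l-1), P (idx (l-1)), v 0` of length `l` with
`3 ≤ l < g`, pairwise distinct vertices and pairwise distinct parts, where each part
`P (idx m)` contains both `v m` and `v (m+1 mod l)`. -/
def ClusterGirthGe {V : Type*} {ι : Type*} (P : ι → Set V) (g : ℕ) : Prop :=
  ∀ l : ℕ, 3 ≤ l → l < g →
    ¬ ∃ (v : Fin l → V) (idx : Fin l → ι),
        Function.Injective v ∧ Function.Injective idx ∧
        ∀ m : Fin l, v m ∈ P (idx m) ∧ v (finRotate l m) ∈ P (idx m)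

/-- In a cluster of cluster-girth at least 4, three distinct vertices that pairwise share a part
all lie in the part shared by the first two. -/
theorem ClusterGirthGe.mem_of_pairwise_mem {V : Type*} {ι : Type*} {P : ι → Set V}
    (hgirth : ClusterGirthGe P 4)
    (hinter : ∀ i j : ι, i ≠ j → ∀ p q : V, p ∈ P i → p ∈ P j → q ∈ P i → q ∈ P j → p = q)
    {a b c : V} {i j k : ι} (hab : a ≠ b) (hbc : b ≠ c) (hca : c ≠ a)
    (hai : a ∈ P i) (hbi : b ∈ P i) (hbj : b ∈ P j) (hcj : c ∈ P j)
    (hck : c ∈ P k) (hak : a ∈ P k) : c ∈ P i := by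
  by_contra hci
  have hij : i ≠ j := by rintro rfl; exact hci hcj
  have hik : i ≠ k := by rintro rfl; exact hci hck
  have hjk : j ≠ k := by
    rintro rfl
    exact hab (hinter i j hij a b hai hak hbi hbj)
  refine hgirth 3 le_rfl (by norm_num) ⟨![a, b, c], ![i, j, k], ?_, ?_, ?_⟩
  · intro m n h
    fin_cases m <;> fin_cases n <;> simp_all
  · intro m n h
    fin_cases m <;> fin_cases n <;> simp_all
  · intro m
    fin_cases m <;> simp [*]

theorem stmt_5 {V : Type*} [Fintype V] {ι : Type*} (G : SimpleGraph V) (P : ι → Set V)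
    -- `G` is a cluster with parts `P i`
    (hcover : ∀ v : V, ∃ i, v ∈ P i)
    (hedge : ∀ u v : V, G.Adj u v → ∃ i, u ∈ P i ∧ v ∈ P i)
    (hinter : ∀ i j : ι, i ≠ j → ∀ p q : V, p ∈ P i → p ∈ P j → q ∈ P i → q ∈ P j → p = q)
    -- the cluster has cluster-girth at least 4
    (hgirth : ClusterGirthGe P 4)
    -- `σ` is a nonempty clique of `G`
    (σ : Finset V) (hne : σ.Nonempty)
    (hclique : ∀ u ∈ σ, ∀ v ∈ σ, u ≠ v → G.Adj u v) :
    ∃ i : ι, (σ : Set V) ⊆ P i := by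
  obtain ⟨a, ha⟩ := hne
  by_cases hb : ∃ b ∈ σ, a ≠ b
  · obtain ⟨b, hb, hab⟩ := hb
    obtain ⟨i, hai, hbi⟩ := hedge a b (hclique a ha b hb hab)
    refine ⟨i, fun c hc ↦ ?_⟩
    by_cases hbc : b = c
    · exact hbc ▸ hbi
    by_cases hca : c = a
    · exact hca ▸ hai
    obtain ⟨j, hbj, hcj⟩ := hedge b c (hclique b hb c hc hbc)
    obtain ⟨k, hck, hak⟩ := hedge c a (hclique c hc a ha hca)
    exact hgirth.mem_of_pairwise_mem hinter hab hbc hca hai hbi hbj hcj hck hak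
  · push Not at hb
    obtain ⟨i, hi⟩ := hcover a
    exact ⟨i, fun c hc ↦ hb c hc ▸ hi⟩
end

section
/- Let G be a simple graph on a finite vertex type V which is a cluster with parts (V i)_{i : ι}, and suppose the cluster has cluster-girth at least 5. Let σ be a nonempty finite set of vertices such that σ is not contained in V i for any i : ι. If v₁ and v₂ are vertices with σ ⊆ N[v₁] and σ ⊆ N[v₂], then v₁ = v₂. -/
/-- Three distinct vertices that pairwise share a part all lie in one part. -/
theorem ClusterGirthGe.exists_common_of_triangle {V ι : Type*} {P : ι → Set V} {g : ℕ}
    (h : ClusterGirthGe P g) (hg : 3 < g) {a b c : V} (hab : a ≠ b) (hbc : b ≠ c) (hca : c ≠ a)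
    (eab : ∃ i, a ∈ P i ∧ b ∈ P i) (ebc : ∃ i, b ∈ P i ∧ c ∈ P i)
    (eca : ∃ i, c ∈ P i ∧ a ∈ P i) : ∃ i, a ∈ P i ∧ b ∈ P i ∧ c ∈ P i := by
  obtain ⟨i, hi⟩ := eab
  obtain ⟨j, hj⟩ := ebc
  obtain ⟨k, hk⟩ := eca
  by_contra hn
  have hij : i ≠ j := by grind
  have hjk : j ≠ k := by grind
  have hki : k ≠ i := by grind
  refine h 3 le_rfl hg ⟨![a, b, c], ![i, j, k], ?_, ?_, ?_⟩
  · intro x y; fin_cases x <;> fin_cases y <;> simp [*, Ne.symm]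
  · intro x y; fin_cases x <;> fin_cases y <;> simp [*, Ne.symm]
  · intro m; fin_cases m <;> simp [*]

/-- In a cluster of girth at least five, opposite vertices of a quadrilateral share a part. -/
theorem ClusterGirthGe.exists_common_of_quadrilateral {V ι : Type*} {P : ι → Set V} {g : ℕ}
    (h : ClusterGirthGe P g) (hg : 4 < g) {a b c d : V} (hab : a ≠ b) (hbc : b ≠ c) (hcd : c ≠ d)
    (hda : d ≠ a) (hac : a ≠ c) (hbd : b ≠ d)
    (hinter : ∀ i j : ι, i ≠ j → ∀ p q : V, p ∈ P i → p ∈ P j → q ∈ P i → q ∈ P j → p = q)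
    (eab : ∃ i, a ∈ P i ∧ b ∈ P i) (ebc : ∃ i, b ∈ P i ∧ c ∈ P i)
    (ecd : ∃ i, c ∈ P i ∧ d ∈ P i) (eda : ∃ i, d ∈ P i ∧ a ∈ P i) :
    ∃ i, a ∈ P i ∧ c ∈ P i := by
  by_contra hn
  have hbd' : ¬ ∃ i, b ∈ P i ∧ d ∈ P i := by
    intro e
    obtain ⟨i, hi⟩ := h.exists_common_of_triangle (by omega) hab hbd hda eab e eda
    obtain ⟨j, hj⟩ := h.exists_common_of_triangle (by omega) hbc hcd hbd.symm ebc ecd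
      (e.imp fun _ h => h.symm)
    by_cases hij : i = j
    · exact hn ⟨i, hi.1, hij ▸ hj.2.1⟩
    · exact hbd (hinter i j hij b d hi.2.1 hj.1 hi.2.2 hj.2.2)
  obtain ⟨i, hi⟩ := eab
  obtain ⟨j, hj⟩ := ebc
  obtain ⟨k, hk⟩ := ecd
  obtain ⟨l, hl⟩ := eda
  have hij : i ≠ j := by grind
  have hik : i ≠ k := by grind
  have hil : i ≠ l := by grind
  have hjk : j ≠ k := by grind
  have hjl : j ≠ l := by grind
  have hkl : k ≠ l := by grind
  refine h 4 (by omega) hg ⟨![a, b, c, d], ![i, j, k, l], ?_, ?_, ?_⟩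
  · intro x y; fin_cases x <;> fin_cases y <;> simp [*, Ne.symm]
  · intro x y; fin_cases x <;> fin_cases y <;> simp [*, Ne.symm]
  · intro m; fin_cases m <;> simp [*]

theorem stmt_6 {V : Type*} [Fintype V] {ι : Type*} (G : SimpleGraph V) (P : ι → Set V)
    -- `G` is a cluster with parts `P i`
    (hcover : ∀ v : V, ∃ i, v ∈ P i)
    (hedge : ∀ u v : V, G.Adj u v → ∃ i, u ∈ P i ∧ v ∈ P i)
    (hinter : ∀ i j : ι, i ≠ j → ∀ p q : V, p ∈ P i → p ∈ P j → q ∈ P i → q ∈ P j → p = q)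
    -- the cluster has cluster-girth at least 5
    (hgirth : ClusterGirthGe P 5)
    -- `σ` is a nonempty finite set of vertices contained in no part
    (σ : Finset V) (hne : σ.Nonempty) (hnot : ∀ i : ι, ¬ (σ : Set V) ⊆ P i)
    -- `σ ⊆ N[v₁]` and `σ ⊆ N[v₂]`
    (v₁ v₂ : V)
    (h1 : ∀ u ∈ σ, u = v₁ ∨ G.Adj u v₁)
    (h2 : ∀ u ∈ σ, u = v₂ ∨ G.Adj u v₂) :
    v₁ = v₂ := by
  have near : ∀ u v : V, u = v ∨ G.Adj u v → ∃ i, u ∈ P i ∧ v ∈ P i := by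
    rintro u v (rfl | huv)
    · exact (hcover u).imp fun _ h => ⟨h, h⟩
    · exact hedge u v huv
  by_contra hv
  by_cases hc : ∃ i, v₁ ∈ P i ∧ v₂ ∈ P i
  · have hc' := hc
    obtain ⟨i, hi₁, hi₂⟩ := hc'
    refine hnot i fun u hu => ?_
    by_cases e₁ : u = v₁
    · exact e₁ ▸ hi₁
    by_cases e₂ : u = v₂
    · exact e₂ ▸ hi₂
    obtain ⟨j, hj, hj₁, hj₂⟩ := hgirth.exists_common_of_triangle (by omega) e₁ hv (Ne.symm e₂)
      (near u v₁ (h1 u hu)) hc ((near u v₂ (h2 u hu)).imp fun _ h => h.symm)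
    by_cases hij : i = j
    · exact hij ▸ hj
    · exact absurd (hinter i j hij v₁ v₂ hi₁ hj₁ hi₂ hj₂) hv
  · have ne₁ : ∀ u ∈ σ, u ≠ v₁ := by
      rintro u hu rfl
      exact hc (near _ _ (h2 _ hu))
    have ne₂ : ∀ u ∈ σ, u ≠ v₂ := by
      rintro u hu rfl
      exact hc ((near _ _ (h1 _ hu)).imp fun _ h => h.symm)
    obtain ⟨u, hu⟩ := hne
    obtain ⟨i, hi⟩ := hcover u
    refine hnot i fun w hw => ?_
    by_cases huw : u = w
    · exact huw ▸ hi
    · exact absurd (hgirth.exists_common_of_quadrilateral (by omega) (ne₁ u hu).symm (ne₂ u hu)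
        (ne₂ w hw).symm (ne₁ w hw) hv huw hinter
        ((near u v₁ (h1 u hu)).imp fun _ h => h.symm) (near u v₂ (h2 u hu))
        ((near w v₂ (h2 w hw)).imp fun _ h => h.symm) (near w v₁ (h1 w hw))) hc
end

section
/- Let G be a simple graph on a finite vertex type V which is a cluster with parts (V i)_{i : ι}, and suppose the cluster has cluster-girth at least 5. Let σ be a finite set of vertices with |σ| ≥ 2 such that σ ⊆ V i for some i : ι. Then for every vertex v with σ ⊆ N[v] we have v ∈ V i. -/
theorem stmt_7 {V : Type*} [Fintype V] {ι : Type*} (G : SimpleGraph V) (P : ι → Set V)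
    -- `G` is a cluster with parts `P i`
    (hcover : ∀ v : V, ∃ i, v ∈ P i)
    (hedge : ∀ u v : V, G.Adj u v → ∃ i, u ∈ P i ∧ v ∈ P i)
    (hinter : ∀ i j : ι, i ≠ j → ∀ p q : V, p ∈ P i → p ∈ P j → q ∈ P i → q ∈ P j → p = q)
    -- the cluster has cluster-girth at least 5
    (hgirth : ClusterGirthGe P 5)
    -- `σ` is a set of at least two vertices contained in the part `P i`
    (σ : Finset V) (hcard : 2 ≤ σ.card) (i : ι) (hσ : (σ : Set V) ⊆ P i)
    -- `v` is a vertex with `σ ⊆ N[v]`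
    (v : V) (hv : ∀ u ∈ σ, u = v ∨ G.Adj u v) :
    v ∈ P i := by
  obtain ⟨a, ha, b, hb, hab⟩ := Finset.one_lt_card.mp hcard
  have hai : a ∈ P i := hσ ha
  have hbi : b ∈ P i := hσ hb
  rcases hv a ha with rfl | hav
  · exact hai
  rcases hv b hb with rfl | hbv
  · exact hbi
  obtain ⟨j, haj, hvj⟩ := hedge a v hav
  obtain ⟨k, hbk, hvk⟩ := hedge b v hbv
  by_contra hvi
  have hij : i ≠ j := fun h => hvi (h ▸ hvj)
  have hik : i ≠ k := fun h => hvi (h ▸ hvk)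
  have hkj : k ≠ j := by
    rintro rfl
    exact hab (hinter i k hik a b hai haj hbi hbk)
  have hav' := hav.ne
  have hbv' := hbv.ne
  refine hgirth 3 le_rfl (by norm_num) ⟨![a, b, v], ![i, k, j], ?_, ?_, ?_⟩
  · intro x y h
    fin_cases x <;> fin_cases y <;> simp_all
  · intro x y h
    fin_cases x <;> fin_cases y <;> simp_all
  · intro m
    fin_cases m
    · exact ⟨hai, hbi⟩
    · exact ⟨hbk, hvk⟩
    · exact ⟨hvj, haj⟩
end

section
/- Let Γ be a group, d ≥ 1, and γ : Fin d → Γ a map such that the pair (Γ, γ) satisfies condition R(2). Then for all x, y : Γ with x ≠ y, the sets {x * γ i : i : Fin d} and {y * γ i : i : Fin d} intersect in at most one element; that is, if p and q both belong to both sets, then p = q. -/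
/-- The pair `(Γ, γ)` satisfies condition `R(p)`: whenever the alternating product
`γ(i 0) * γ(i 1)⁻¹ * ⋯ * γ(i (2p-2)) * γ(i (2p-1))⁻¹` equals `1`, two cyclically
consecutive indices coincide. -/
def CondR {Γ : Type*} [Group Γ] {d : ℕ} (γ : Fin d → Γ) (p : ℕ) : Prop :=
  ∀ i : Fin (2 * p) → Fin d,
    (List.ofFn (fun l : Fin p =>
        γ (i ⟨2 * l.val, by have := l.isLt; omega⟩) *
          (γ (i ⟨2 * l.val + 1, by have := l.isLt; omega⟩))⁻¹)).prod = 1 →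
    ∃ l : Fin (2 * p), i l = i (finRotate (2 * p) l)

theorem CondR.two_eq {Γ : Type*} [Group Γ] {d : ℕ} {γ : Fin d → Γ} (hR : CondR γ 2)
    {a b c e : Fin d} (h : γ a * (γ b)⁻¹ * (γ c * (γ e)⁻¹) = 1) :
    a = b ∨ b = c ∨ c = e ∨ e = a := by
  obtain ⟨l, hl⟩ := hR ![a, b, c, e] (by simpa [List.ofFn_succ] using h)
  change Fin 4 at l
  fin_cases l
  · exact .inl hl
  · exact .inr (.inl hl)
  · exact .inr (.inr (.inl hl))
  · exact .inr (.inr (.inr hl))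

theorem stmt_9 {Γ : Type*} [Group Γ] {d : ℕ} (hd : 1 ≤ d) (γ : Fin d → Γ)
    (hR : CondR γ 2)
    (x y : Γ) (hxy : x ≠ y) (p q : Γ)
    (hpx : ∃ i : Fin d, p = x * γ i) (hpy : ∃ i : Fin d, p = y * γ i)
    (hqx : ∃ i : Fin d, q = x * γ i) (hqy : ∃ i : Fin d, q = y * γ i) :
    p = q := by
  obtain ⟨a, ha⟩ := hpx
  obtain ⟨b, hb⟩ := hpy
  obtain ⟨c, hc⟩ := hqx
  obtain ⟨e, he⟩ := hqy
  have hprod : γ a * (γ b)⁻¹ * (γ e * (γ c)⁻¹) = 1 := by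
    rw [← inv_mul_eq_iff_eq_mul.mpr ha, ← inv_mul_eq_iff_eq_mul.mpr hb,
      ← inv_mul_eq_iff_eq_mul.mpr hc, ← inv_mul_eq_iff_eq_mul.mpr he]
    group
  rcases hR.two_eq hprod with rfl | rfl | rfl | rfl
  · exact absurd (mul_right_cancel (ha.symm.trans hb)) hxy
  · exact hb.trans he.symm
  · exact absurd (mul_right_cancel (hc.symm.trans he)) hxy
  · exact ha.trans hc.symm
end

section
/- Let Γ be a group, d ≥ 1, H a simple graph on Fin d, and γ : Fin d → Γ a map such that the pair (Γ, γ) satisfies conditions R(1) and R(2). Then for every g : Γ and all i, j : Fin d with i ≠ j, the vertices g * γ i and g * γ j are adjacent in H̃ if and only if i and j are adjacent in H. -/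
theorem CondR.injective {Γ : Type*} [Group Γ] {d : ℕ} {γ : Fin d → Γ} (h : CondR γ 1) :
    Function.Injective γ := by
  intro a b hab
  obtain ⟨l, hl⟩ := h ![a, b] (by simp [List.ofFn_succ, hab])
  have key : ∀ l : Fin 2, ![a, b] l = ![a, b] (finRotate 2 l) → a = b := by
    intro l hl
    fin_cases l
    · simpa using hl
    · simpa using hl.symm
  exact key l hl

theorem CondR.eq_or_eq_of_mul_eq_one {Γ : Type*} [Group Γ] {d : ℕ} {γ : Fin d → Γ}
    (h : CondR γ 2) {a b c e : Fin d} (habce : γ a * (γ b)⁻¹ * (γ c * (γ e)⁻¹) = 1) :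
    a = b ∨ b = c ∨ c = e ∨ e = a := by
  obtain ⟨l, hl⟩ := h ![a, b, c, e] (by simpa [List.ofFn_succ] using habce)
  have key : ∀ l : Fin 4, ![a, b, c, e] l = ![a, b, c, e] (finRotate 4 l) →
      a = b ∨ b = c ∨ c = e ∨ e = a := by
    intro l hl
    fin_cases l
    · exact Or.inl hl
    · exact Or.inr (Or.inl hl)
    · exact Or.inr (Or.inr (Or.inl hl))
    · exact Or.inr (Or.inr (Or.inr hl))
  exact key l hl

theorem stmt_10 {Γ : Type*} [Group Γ] {d : ℕ} (hd : 1 ≤ d)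
    (H : SimpleGraph (Fin d)) (γ : Fin d → Γ)
    (hR1 : CondR γ 1) (hR2 : CondR γ 2)
    -- Ht is the graph H-tilde on vertex set Γ
    (Ht : SimpleGraph Γ)
    (hHt : ∀ x y : Γ, Ht.Adj x y ↔ x ≠ y ∧ ∃ (g : Γ) (i j : Fin d),
      H.Adj i j ∧ x = g * γ i ∧ y = g * γ j)
    (g : Γ) (i j : Fin d) (hij : i ≠ j) :
    Ht.Adj (g * γ i) (g * γ j) ↔ H.Adj i j := by
  have hinj := hR1.injective
  rw [hHt]
  refine ⟨?_, fun h => ⟨fun he => hij (hinj (mul_left_cancel he)), g, i, j, h, rfl, rfl⟩⟩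
  rintro ⟨-, g', k, l, hkl, hk, hl⟩
  have hk' : γ k * (γ i)⁻¹ = g'⁻¹ * g := by
    rw [mul_inv_eq_iff_eq_mul, mul_assoc, hk, inv_mul_cancel_left]
  have hl' : γ l * (γ j)⁻¹ = g'⁻¹ * g := by
    rw [mul_inv_eq_iff_eq_mul, mul_assoc, hl, inv_mul_cancel_left]
  have heq : γ k * (γ i)⁻¹ = γ l * (γ j)⁻¹ := hk'.trans hl'.symm
  have hprod : γ k * (γ i)⁻¹ * (γ j * (γ l)⁻¹) = 1 := by
    rw [heq]
    group
  rcases hR2.eq_or_eq_of_mul_eq_one hprod with rfl | h | rfl | h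
  · rw [mul_inv_cancel, eq_comm, mul_inv_eq_one] at heq
    rwa [← hinj heq]
  · exact absurd h hij
  · rw [mul_inv_cancel, mul_inv_eq_one] at heq
    rwa [← hinj heq]
  · exact absurd h.symm hkl.ne
end

section
/- Let Γ be a group, d ≥ 1, p ≥ 2, and γ : Fin d → Γ a map such that the pair (Γ, γ) satisfies condition R(q) for all 1 ≤ q ≤ p. Let k be an integer with 3 ≤ k ≤ p. Then there do not exist pairwise distinct elements τ 0, …, τ (k−1) : Γ, pairwise distinct elements v 0, …, v (k−1) : Γ, and indices i 0, …, i (k−1), i' 0, …, i' (k−1) : Fin d such that v l = τ (l−1 mod k) * γ (i l) and v l = τ l * γ (i' l) for all l = 0, …, k−1. (In other words, the cluster of translates {τ * γ i : i : Fin d}, τ : Γ, has cluster-girth at least p+1.) -/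
theorem val_finRotate_eq_mod (n : ℕ) (l : Fin n) :
    (finRotate n l : ℕ) = ((l : ℕ) + 1) % n := by
  cases n with
  | zero => exact l.elim0
  | succ m => rw [finRotate_apply, Fin.val_add, Fin.val_one', Nat.add_mod_mod]

theorem List.prod_ofFn_inv_mul_succ {G : Type*} [Group G] (t : ℕ → G) (n : ℕ) :
    (List.ofFn fun l : Fin n => (t l)⁻¹ * t (l + 1)).prod = (t 0)⁻¹ * t n := by
  induction n with
  | zero => simp
  | succ n ih =>
    rw [List.ofFn_succ']
    simp [ih, mul_assoc]

theorem stmt_11 {Γ : Type*} [Group Γ] {d p : ℕ} (hd : 1 ≤ d) (hp : 2 ≤ p)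
    (γ : Fin d → Γ)
    (hR : ∀ q : ℕ, 1 ≤ q → q ≤ p → CondR γ q)
    (k : ℕ) (hk3 : 3 ≤ k) (hkp : k ≤ p) :
    ¬ ∃ (τ : Fin k → Γ) (v : Fin k → Γ) (idx idx' : Fin k → Fin d),
        Function.Injective τ ∧ Function.Injective v ∧
        ∀ l : Fin k,
          v l = τ ((finRotate k).symm l) * γ (idx l) ∧ v l = τ l * γ (idx' l) := by
  rintro ⟨τ, v, idx, idx', hτ, hv, h⟩
  have hk : 0 < k := by omega
  let j : Fin (2 * k) → Fin d := fun m =>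
    if m.val % 2 = 0 then idx ⟨m.val / 2, by omega⟩ else idx' ⟨m.val / 2, by omega⟩
  have j_even (l : Fin k) (hl : 2 * l.val < 2 * k) : j ⟨2 * l.val, hl⟩ = idx l := by
    simp [j]
  have j_odd (l : Fin k) (hl : 2 * l.val + 1 < 2 * k) :
      j ⟨2 * l.val + 1, hl⟩ = idx' l := by
    have h1 : (2 * l.val + 1) % 2 ≠ 0 := by omega
    have h2 : (2 * l.val + 1) / 2 = l.val := by omega
    simp only [j, if_neg h1, h2]
  have val_symm (l : Fin k) : ((finRotate k).symm l : ℕ) = (l.val + (k - 1)) % k := by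
    have e := val_finRotate_eq_mod k ((finRotate k).symm l)
    rw [Equiv.apply_symm_apply] at e
    have hl := ((finRotate k).symm l).isLt
    rcases Nat.lt_or_ge (((finRotate k).symm l : ℕ) + 1) k with hlt | hge
    · rw [Nat.mod_eq_of_lt hlt] at e
      rw [show l.val + (k - 1) = ((finRotate k).symm l : ℕ) + k by omega, Nat.add_mod_right,
        Nat.mod_eq_of_lt hl]
    · rw [show ((finRotate k).symm l : ℕ) + 1 = k by omega, Nat.mod_self] at e
      rw [e, Nat.mod_eq_of_lt (by omega)]
      omega
  let t : ℕ → Γ := fun m => τ ⟨(m + (k - 1)) % k, Nat.mod_lt _ hk⟩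
  have t_val (l : Fin k) : t l = τ ((finRotate k).symm l) :=
    congrArg τ (Fin.ext (val_symm l).symm)
  have t_succ (l : Fin k) : t (l + 1) = τ l := by
    refine congrArg τ (Fin.ext ?_)
    change (l.val + 1 + (k - 1)) % k = l.val
    rw [show l.val + 1 + (k - 1) = l.val + k by omega, Nat.add_mod_right,
      Nat.mod_eq_of_lt l.isLt]
  have t_period : t k = t 0 := by simp [t]
  obtain ⟨m, hm⟩ := hR k (by omega) hkp j (by
    have key := List.prod_ofFn_inv_mul_succ t k
    rw [t_period, inv_mul_cancel] at key
    rw [← key]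
    congr 2
    funext l
    rw [j_even, j_odd, t_val, t_succ, mul_inv_eq_iff_eq_mul, mul_assoc, eq_inv_mul_iff_mul_eq,
      ← (h l).1, ← (h l).2])
  have hm' := val_finRotate_eq_mod (2 * k) m
  have hml := m.isLt
  let l : Fin k := ⟨m.val / 2, by omega⟩
  rcases Nat.mod_two_eq_zero_or_one m.val with hpar | hpar
  · have em : m = ⟨2 * l.val, by omega⟩ := Fin.ext (by change m.val = 2 * (m.val / 2); omega)
    have er : finRotate (2 * k) m = ⟨2 * l.val + 1, by omega⟩ := Fin.ext (by
      rw [hm', Nat.mod_eq_of_lt (by omega)]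
      change m.val + 1 = 2 * (m.val / 2) + 1
      omega)
    rw [er, j_odd, em, j_even] at hm
    have e : τ ((finRotate k).symm l) = τ l := by
      have e' := (h l).1.symm.trans (h l).2
      rw [hm] at e'
      exact mul_right_cancel e'
    have e2 := val_finRotate_eq_mod k l
    rw [← (Equiv.symm_apply_eq _).1 (hτ e)] at e2
    rcases Nat.lt_or_ge (l.val + 1) k with hlt | hge
    · rw [Nat.mod_eq_of_lt hlt] at e2
      omega
    · rw [show l.val + 1 = k by omega, Nat.mod_self] at e2
      omega
  · have em : m = ⟨2 * l.val + 1, by omega⟩ :=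
      Fin.ext (by change m.val = 2 * (m.val / 2) + 1; omega)
    have hrot := val_finRotate_eq_mod k l
    have er : finRotate (2 * k) m = ⟨2 * (finRotate k l).val, by omega⟩ := Fin.ext (by
      rw [hm']
      change (m.val + 1) % (2 * k) = 2 * (finRotate k l).val
      rw [hrot, ← Nat.mul_mod_mul_left]
      congr 1
      change m.val + 1 = 2 * (m.val / 2 + 1)
      omega)
    rw [er, j_even, em, j_odd] at hm
    have e : v l = v (finRotate k l) := by
      rw [(h l).2, (h (finRotate k l)).1, Equiv.symm_apply_apply, hm]
    rw [← hv e] at hrot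
    rcases Nat.lt_or_ge (l.val + 1) k with hlt | hge
    · rw [Nat.mod_eq_of_lt hlt] at hrot
      omega
    · rw [show l.val + 1 = k by omega, Nat.mod_self] at hrot
      omega
end

section
/- For every p ≥ 2 and every d ≥ 3 there exist a finite group Γ and an injective map γ : Fin d → Γ such that the pair (Γ, γ) satisfies condition R(q) for all 1 ≤ q ≤ p. -/
/-- The reduced words of length at most `N` over `α`: lists without two equal consecutive letters.
They are the vertices of a ball in the `α`-edge-coloured regular tree. -/
abbrev ReducedWord (α : Type*) (N : ℕ) : Type _ :=
  {w : List α // w.IsChain (· ≠ ·) ∧ w.length ≤ N}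

namespace ReducedWord

variable {α : Type*} {N : ℕ}

instance [Finite α] : Finite (ReducedWord α N) :=
  ((List.finite_length_le α N).subset fun _ h => h.2).to_subtype

/-- The empty word, i.e. the centre of the ball. -/
def nil (α : Type*) (N : ℕ) : ReducedWord α N := ⟨[], by simp⟩

open Classical in
/-- Move along the edge of colour `a`, or stay put if there is no such edge in the ball. -/
noncomputable def step (a : α) (w : ReducedWord α N) : ReducedWord α N :=
  if w.1.head? = some a then ⟨w.1.tail, w.2.1.tail, by have := w.2.2; grind⟩
  else if h : (a :: w.1).IsChain (· ≠ ·) ∧ (a :: w.1).length ≤ N then ⟨a :: w.1, h⟩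
  else w

theorem step_eq_cons {a : α} {w : List α} (h : (a :: w).IsChain (· ≠ ·) ∧ (a :: w).length ≤ N)
    (hw : w.IsChain (· ≠ ·) ∧ w.length ≤ N) : step a ⟨w, hw⟩ = ⟨a :: w, h⟩ := by
  have : w.head? ≠ some a := by
    intro h0
    cases w <;> simp_all
  simp only [step, if_neg this, dif_pos h]

theorem step_involutive (a : α) : Function.Involutive (step a : ReducedWord α N → _) := by
  rintro ⟨w, hw⟩
  by_cases h0 : w.head? = some a
  · obtain ⟨v, rfl⟩ : ∃ v, w = a :: v := by
      cases w <;> simp_all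
    have hv : v.IsChain (· ≠ ·) ∧ v.length ≤ N := ⟨hw.1.tail, by have := hw.2; grind⟩
    rw [← step_eq_cons hw hv]
    have : step a (step a ⟨v, hv⟩) = ⟨v, hv⟩ := by
      rw [step_eq_cons hw hv]
      simp [step]
    rw [this]
  · by_cases h : (a :: w).IsChain (· ≠ ·) ∧ (a :: w).length ≤ N
    · rw [step_eq_cons h hw]
      simp [step]
    · have : step a ⟨w, hw⟩ = ⟨w, hw⟩ := by
        simp only [step, if_neg h0, dif_neg h]
      rw [this, this]

/-- `ReducedWord.step` as a permutation. -/
noncomputable def stepPerm (N : ℕ) (a : α) : Equiv.Perm (ReducedWord α N) :=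
  (step_involutive a).toPerm

/-- A product of steps sends the centre of the ball to the vertex spelled by the colours. -/
theorem prod_map_stepPerm_nil (w : List α) (hw : w.IsChain (· ≠ ·) ∧ w.length ≤ N) :
    (w.map (stepPerm N)).prod (nil α N) = ⟨w, hw⟩ := by
  induction w with
  | nil => rfl
  | cons a v ih =>
    have hv : v.IsChain (· ≠ ·) ∧ v.length ≤ N := ⟨hw.1.tail, by have := hw.2; grind⟩
    rw [List.map_cons, List.prod_cons, Equiv.Perm.mul_apply, ih hv]
    exact step_eq_cons hw hv

theorem stepPerm_injective (hN : 1 ≤ N) : Function.Injective (stepPerm N : α → _) := by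
  intro a b hab
  have key (c : α) : stepPerm N c (nil α N) = ⟨[c], by simpa using hN⟩ := by
    simpa using prod_map_stepPerm_nil [c] (by simpa using hN)
  have := key a
  rw [hab, key b] at this
  simpa using (congrArg Subtype.val this).symm

end ReducedWord

theorem condR_stepPerm {d N q : ℕ} (hq : 1 ≤ q) (hN : 2 * q ≤ N) :
    CondR (ReducedWord.stepPerm N : Fin d → _) q := by
  intro i hprod
  by_contra! hne
  have hchain : (List.ofFn i).IsChain (· ≠ ·) := by
    rw [List.isChain_iff_getElem]
    intro l hl
    rw [List.length_ofFn] at hl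
    have := hne ⟨l, by omega⟩
    obtain ⟨k, rfl⟩ : ∃ k, q = k + 1 := ⟨q - 1, by omega⟩
    have hr : finRotate (2 * (k + 1)) ⟨l, by omega⟩ = ⟨l + 1, hl⟩ :=
      finRotate_of_lt (n := 2 * k + 1) (by omega)
    rw [hr] at this
    simpa only [List.getElem_ofFn] using this
  have hw : (List.ofFn i).IsChain (· ≠ ·) ∧ (List.ofFn i).length ≤ N :=
    ⟨hchain, by simpa using hN⟩
  have hword : ((List.ofFn i).map (ReducedWord.stepPerm N)).prod = 1 := by
    rw [← hprod, List.ofFn_mul' i, List.map_flatten, List.prod_flatten, List.map_map,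
      List.map_ofFn]
    congr 2
  have := ReducedWord.prod_map_stepPerm_nil _ hw
  rw [hword] at this
  have := congrArg (fun w => w.1.length) this
  simp [ReducedWord.nil] at this
  omega

theorem stmt_13 (p d : ℕ) (hp : 2 ≤ p) (hd : 3 ≤ d) :
    ∃ (Γ : Type) (instΓ : Group Γ) (_ : Fintype Γ) (γ : Fin d → Γ),
      Function.Injective γ ∧ ∀ q : ℕ, 1 ≤ q → q ≤ p → @CondR Γ instΓ d γ q :=
  ⟨Equiv.Perm (ReducedWord (Fin d) (2 * p)), inferInstance, Fintype.ofFinite _,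
    ReducedWord.stepPerm (2 * p), ReducedWord.stepPerm_injective (by omega),
    fun _ hq hqp => condR_stepPerm hq (by omega)⟩
end

section
/- Let d ≥ 1, let a : Fin d → ℕ be strictly monotone with 0 < a 0 and progression-free, and let m be a natural number with m > 4 * (a of the last index). Let Γ = Equiv.Perm (Fin (d+1)) × ZMod m and define γ : Fin d → Γ by γ i = (Equiv.swap 0 (i.succ), (a i : ZMod m)), where i.succ : Fin (d+1) is the successor embedding and 0 : Fin (d+1) plays the role of the distinguished point. Then the pair (Γ, γ) satisfies condition R(q) for all 1 ≤ q ≤ 4. -/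
open Equiv in
/-- A product of four star transpositions with distinct consecutive leaves is not `1`. -/
theorem swap_prod_four_ne_one {α : Type*} [DecidableEq α] {o x₀ x₁ x₂ x₃ : α}
    (h₁ : x₁ ≠ o) (h₂ : x₂ ≠ o) (n₀ : x₀ ≠ x₁) (n₁ : x₁ ≠ x₂) (n₂ : x₂ ≠ x₃) :
    swap o x₀ * swap o x₁ * (swap o x₂ * swap o x₃) ≠ 1 := by
  intro H
  have key (p : α) : swap o x₀ (swap o x₁ p) = swap o x₃ (swap o x₂ p) := by
    have := congrArg (fun σ : Perm α => σ (swap o x₃ (swap o x₂ p))) H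
    simpa using this
  have e := key o
  have e₀ := key x₀
  have e₁ := key x₁
  have e₂ := key x₂
  have e₃ := key x₃
  clear H key
  simp only [swap_apply_def] at *
  grind

open Equiv in
/-- A trivial product of six star transpositions with distinct consecutive leaves
has the form `(xy)³`. -/
theorem swap_prod_six_eq_one {α : Type*} [DecidableEq α] {o x₀ x₁ x₂ x₃ x₄ x₅ : α}
    (h₀ : x₀ ≠ o) (h₁ : x₁ ≠ o) (h₂ : x₂ ≠ o) (h₃ : x₃ ≠ o) (h₄ : x₄ ≠ o) (h₅ : x₅ ≠ o)
    (n₀ : x₀ ≠ x₁) (n₁ : x₁ ≠ x₂) (n₂ : x₂ ≠ x₃) (n₃ : x₃ ≠ x₄) (n₄ : x₄ ≠ x₅)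
    (H : swap o x₀ * swap o x₁ * (swap o x₂ * swap o x₃ * (swap o x₄ * swap o x₅)) = 1) :
    x₀ = x₂ ∧ x₀ = x₄ ∧ x₁ = x₃ ∧ x₁ = x₅ := by
  have key (p : α) : swap o x₀ (swap o x₁ (swap o x₂ p)) =
      swap o x₅ (swap o x₄ (swap o x₃ p)) := by
    have := congrArg (fun σ : Perm α => σ (swap o x₅ (swap o x₄ (swap o x₃ p)))) H
    simpa using this
  have e := key o
  have e₀ := key x₀
  have e₁ := key x₁
  have e₂ := key x₂
  have e₃ := key x₃
  have e₄ := key x₄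
  have e₅ := key x₅
  clear H key
  simp only [swap_apply_def] at *
  grind

open Equiv in
set_option maxHeartbeats 4000000 in
/-- The classification of trivial products of eight star transpositions with cyclically
distinct consecutive leaves: up to renaming leaves, there are six words. -/
theorem swap_prod_eight_eq_one {α : Type*} [DecidableEq α] {o x₀ x₁ x₂ x₃ x₄ x₅ x₆ x₇ : α}
    (h₀ : x₀ ≠ o) (h₁ : x₁ ≠ o) (h₂ : x₂ ≠ o) (h₃ : x₃ ≠ o)
    (h₄ : x₄ ≠ o) (h₅ : x₅ ≠ o) (h₆ : x₆ ≠ o) (h₇ : x₇ ≠ o)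
    (n₀ : x₀ ≠ x₁) (n₁ : x₁ ≠ x₂) (n₂ : x₂ ≠ x₃) (n₃ : x₃ ≠ x₄)
    (n₄ : x₄ ≠ x₅) (n₅ : x₅ ≠ x₆) (n₆ : x₆ ≠ x₇) (n₇ : x₇ ≠ x₀)
    (H : swap o x₀ * swap o x₁ * (swap o x₂ * swap o x₃ *
      (swap o x₄ * swap o x₅ * (swap o x₆ * swap o x₇))) = 1) :
    (x₀ = x₂ ∧ x₀ = x₄ ∧ x₀ = x₆ ∧ x₁ = x₅ ∧ x₃ = x₇) ∨
    (x₁ = x₃ ∧ x₁ = x₅ ∧ x₁ = x₇ ∧ x₂ = x₆ ∧ x₀ = x₄) ∨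
    (x₀ = x₂ ∧ x₀ = x₅ ∧ x₁ = x₄ ∧ x₁ = x₆ ∧ x₃ = x₇) ∨
    (x₀ = x₃ ∧ x₀ = x₅ ∧ x₁ = x₄ ∧ x₁ = x₇ ∧ x₂ = x₆) ∨
    (x₀ = x₃ ∧ x₀ = x₆ ∧ x₁ = x₅ ∧ x₂ = x₄ ∧ x₂ = x₇) ∨
    (x₀ = x₄ ∧ x₁ = x₃ ∧ x₁ = x₆ ∧ x₂ = x₅ ∧ x₂ = x₇) := by
  have key (p : α) : swap o x₀ (swap o x₁ (swap o x₂ (swap o x₃ p))) =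
      swap o x₇ (swap o x₆ (swap o x₅ (swap o x₄ p))) := by
    have := congrArg
      (fun σ : Perm α => σ (swap o x₇ (swap o x₆ (swap o x₅ (swap o x₄ p))))) H
    simpa using this
  have e := key o
  have e₀ := key x₀
  have e₁ := key x₁
  have e₂ := key x₂
  have e₃ := key x₃
  have e₄ := key x₄
  have e₅ := key x₅
  have e₆ := key x₆
  have e₇ := key x₇
  clear H key
  simp only [swap_apply_def] at *
  grind (splits := 60)

theorem stmt_14 {d : ℕ} (hd : 1 ≤ d) (a : Fin d → ℕ) (hmono : StrictMono a)
    (hpos : 0 < a ⟨0, by omega⟩)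
    -- a is progression-free
    (hprog : ∀ i j k : Fin d, a i + a j = 2 * a k → i = j ∧ j = k)
    (m : ℕ) (hm : m > 4 * a ⟨d - 1, by omega⟩)
    (γ : Fin d → Equiv.Perm (Fin (d + 1)) × Multiplicative (ZMod m))
    (hγ : ∀ i : Fin d,
      γ i = (Equiv.swap 0 i.succ, Multiplicative.ofAdd ((a i : ZMod m)))) :
    ∀ q : ℕ, 1 ≤ q → q ≤ 4 → CondR γ q := by
  have hbound (j : Fin d) : 4 * (a j : ℤ) < m := by
    have : a j ≤ a ⟨d - 1, by omega⟩ := hmono.monotone (Fin.le_def.2 (by simp; omega))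
    omega
  have eq_zero {s : ℤ} (hs : (s : ZMod m) = 0) (h : |s| < m) : s = 0 :=
    Int.eq_zero_of_abs_lt_dvd ((ZMod.intCast_zmod_eq_zero_iff_dvd s m).1 hs) h
  have hne (j : Fin d) : j.succ ≠ 0 := Fin.succ_ne_zero j
  have hsucc {j k : Fin d} (h : j ≠ k) : j.succ ≠ k.succ := fun h' => h (Fin.succ_injective d h')
  intro q hq₁ hq₄ i hi
  by_contra! hcyc
  interval_cases q
  · simp only [List.ofFn_succ, hγ, Prod.ext_iff] at hi
    have n₀ : i 0 ≠ i 1 := hcyc 0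
    have := congrArg (fun σ : Equiv.Perm (Fin (d + 1)) => σ (i 1).succ) hi.1
    simp [hsucc n₀] at this
  · simp [List.ofFn_succ, hγ, Prod.ext_iff] at hi
    exact swap_prod_four_ne_one (hne _) (hne _)
      (hsucc (hcyc 0)) (hsucc (hcyc 1)) (hsucc (hcyc 2)) hi.1
  · simp [List.ofFn_succ, hγ, Prod.ext_iff] at hi
    have n₀ : i 0 ≠ i 1 := hcyc 0
    have hword := swap_prod_six_eq_one (hne (i 0)) (hne (i 1)) (hne (i 2))
      (hne (i 3)) (hne (i 4)) (hne (i 5))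
      (hsucc (hcyc 0)) (hsucc (hcyc 1)) (hsucc (hcyc 2)) (hsucc (hcyc 3)) (hsucc (hcyc 4)) hi.1
    simp only [Fin.succ_inj] at hword
    have hsum : (a (i 0) - a (i 1) + (a (i 2) - a (i 3) + (a (i 4) - a (i 5))) : ℤ) = 0 := by
      refine eq_zero ?_ ?_
      · simpa [sub_eq_add_neg] using congrArg Multiplicative.toAdd hi.2
      · have b (j : Fin 6) := hbound (i j)
        have := b 0; have := b 1; have := b 2; have := b 3; have := b 4; have := b 5
        rw [abs_lt]; omega
    obtain ⟨e₀, e₁, e₂, e₃⟩ := hword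
    rw [← e₀, ← e₁, ← e₂, ← e₃] at hsum
    exact n₀ (hmono.injective (by omega))
  · simp [List.ofFn_succ, hγ, Prod.ext_iff] at hi
    have n₀ : i 0 ≠ i 1 := hcyc 0
    have n₁ : i 1 ≠ i 2 := hcyc 1
    have hword := swap_prod_eight_eq_one (hne (i 0)) (hne (i 1)) (hne (i 2)) (hne (i 3))
      (hne (i 4)) (hne (i 5)) (hne (i 6)) (hne (i 7))
      (hsucc (hcyc 0)) (hsucc (hcyc 1)) (hsucc (hcyc 2)) (hsucc (hcyc 3))
      (hsucc (hcyc 4)) (hsucc (hcyc 5)) (hsucc (hcyc 6)) (hsucc (hcyc 7)) hi.1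
    simp only [Fin.succ_inj] at hword
    have hsum : (a (i 0) - a (i 1) + (a (i 2) - a (i 3) +
        (a (i 4) - a (i 5) + (a (i 6) - a (i 7)))) : ℤ) = 0 := by
      refine eq_zero ?_ ?_
      · simpa [sub_eq_add_neg] using congrArg Multiplicative.toAdd hi.2
      · have b (j : Fin 8) := hbound (i j)
        have := b 0; have := b 1; have := b 2; have := b 3
        have := b 4; have := b 5; have := b 6; have := b 7
        rw [abs_lt]; omega
    rcases hword with ⟨e₀, e₁, e₂, e₃, e₄⟩ | ⟨e₀, e₁, e₂, e₃, e₄⟩ | ⟨e₀, e₁, e₂, e₃, e₄⟩ |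
      ⟨e₀, e₁, e₂, e₃, e₄⟩ | ⟨e₀, e₁, e₂, e₃, e₄⟩ | ⟨e₀, e₁, e₂, e₃, e₄⟩ <;>
      rw [← e₀, ← e₁, ← e₂, ← e₃, ← e₄] at hsum
    · obtain ⟨h, h'⟩ := hprog (i 1) (i 3) (i 0) (by omega)
      exact n₀ (h.trans h').symm
    · obtain ⟨-, h⟩ := hprog (i 0) (i 2) (i 1) (by omega)
      exact n₁ h.symm
    · obtain ⟨h, -⟩ := hprog (i 0) (i 1) (i 3) (by omega)
      exact n₀ h
    · obtain ⟨h, -⟩ := hprog (i 0) (i 1) (i 2) (by omega)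
      exact n₀ h
    · obtain ⟨-, h⟩ := hprog (i 0) (i 2) (i 1) (by omega)
      exact n₁ h.symm
    · obtain ⟨h, -⟩ := hprog (i 1) (i 2) (i 0) (by omega)
      exact n₁ h
end

section
/- Let α be a type with decidable equality, let x : α, and let a₀, a₁, a₂, a₃, a₄, a₅ : α all be distinct from x. If the product (Equiv.swap x a₀) * (Equiv.swap x a₁) * (Equiv.swap x a₂) * (Equiv.swap x a₃) * (Equiv.swap x a₄) * (Equiv.swap x a₅) equals the identity permutation, then either a_l = a_{l+1 mod 6} for some l = 0, …, 5, or (a₀ = a₂ and a₂ = a₄ and a₁ = a₃ and a₃ = a₅). -/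
theorem stmt_16 {α : Type*} [DecidableEq α] (x a₀ a₁ a₂ a₃ a₄ a₅ : α)
    (h₀ : a₀ ≠ x) (h₁ : a₁ ≠ x) (h₂ : a₂ ≠ x) (h₃ : a₃ ≠ x) (h₄ : a₄ ≠ x) (h₅ : a₅ ≠ x)
    (h : Equiv.swap x a₀ * Equiv.swap x a₁ * Equiv.swap x a₂ * Equiv.swap x a₃ *
        Equiv.swap x a₄ * Equiv.swap x a₅ = 1) :
    (a₀ = a₁ ∨ a₁ = a₂ ∨ a₂ = a₃ ∨ a₃ = a₄ ∨ a₄ = a₅ ∨ a₅ = a₀) ∨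
      (a₀ = a₂ ∧ a₂ = a₄ ∧ a₁ = a₃ ∧ a₃ = a₅) := by
  have key (y : α) := DFunLike.congr_fun h y
  simp only [Equiv.Perm.mul_apply, Equiv.Perm.one_apply, Equiv.swap_apply_def] at key
  have k := key x
  have k₀ := key a₀
  have k₁ := key a₁
  have k₂ := key a₂
  have k₃ := key a₃
  have k₄ := key a₄
  have k₅ := key a₅
  clear key h
  grind
end

section
/- Let α be a type with decidable equality, let x : α, and let a₀, …, a₇ : α all be distinct from x. If the product (Equiv.swap x a₀) * (Equiv.swap x a₁) * ⋯ * (Equiv.swap x a₇) equals the identity permutation, then either a_l = a_{l+1 mod 8} for some l = 0, …, 7, or there exist a cyclic shift s : Fin 8 and elements i, j, k : α such that the shifted sequence (a_{s}, a_{s+1}, …, a_{s+7}) (indices mod 8) equals (i, j, i, k, i, j, i, k) or equals (i, j, i, k, j, i, j, k). -/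
/-- A map that is injective on a set commutes with transpositions of elements of that set. -/
theorem Set.InjOn.map_swap_apply {α β : Type*} [DecidableEq α] [DecidableEq β] {g : α → β}
    {S : Set α} (hg : S.InjOn g) {x b y : α} (hx : x ∈ S) (hb : b ∈ S) (hy : y ∈ S) :
    g (Equiv.swap x b y) = Equiv.swap (g x) (g b) (g y) := by
  simp only [Equiv.swap_apply_def, hg.eq_iff hy hx, hg.eq_iff hy hb]
  split_ifs <;> rfl

/-- A transposition of elements of a set maps the set into itself. -/
theorem Equiv.swap_apply_mem {α : Type*} [DecidableEq α] {S : Set α} {x b y : α}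
    (hx : x ∈ S) (hb : b ∈ S) (hy : y ∈ S) : Equiv.swap x b y ∈ S := by
  rw [Equiv.swap_apply_def]
  split_ifs <;> assumption

/-- A map that is injective on a set commutes with products of star transpositions of that set. -/
theorem Set.InjOn.map_prod_swap_apply {α β : Type*} [DecidableEq α] [DecidableEq β] {g : α → β}
    {S : Set α} (hg : S.InjOn g) {x : α} (hx : x ∈ S) (w : List α) (hw : ∀ b ∈ w, b ∈ S)
    {y : α} (hy : y ∈ S) :
    (w.map (Equiv.swap x)).prod y ∈ S ∧
      g ((w.map (Equiv.swap x)).prod y) =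
        (w.map fun b => Equiv.swap (g x) (g b)).prod (g y) := by
  induction w with
  | nil => simpa using hy
  | cons b w ih =>
    obtain ⟨hmem, heq⟩ := ih fun c hc => hw c (List.mem_cons_of_mem b hc)
    have hb := hw b List.mem_cons_self
    simp only [List.map_cons, List.prod_cons, Equiv.Perm.mul_apply]
    exact ⟨Equiv.swap_apply_mem hx hb hmem, by rw [hg.map_swap_apply hx hb hmem, heq]⟩

/-- The word `p` read cyclically from position `s` has the form `i j i k i j i k` or
`i j i k j i j k`. -/
def IsStarPatternAt {α : Type*} (p : Fin 8 → α) (s : Fin 8) : Prop :=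
  p (s + 2) = p s ∧ p (s + 7) = p (s + 3) ∧
    ((p (s + 4) = p s ∧ p (s + 5) = p (s + 1) ∧ p (s + 6) = p s) ∨
      (p (s + 4) = p (s + 1) ∧ p (s + 5) = p s ∧ p (s + 6) = p (s + 1)))

instance {α : Type*} [DecidableEq α] (p : Fin 8 → α) (s : Fin 8) :
    Decidable (IsStarPatternAt p s) := by
  unfold IsStarPatternAt
  infer_instance

/-- The classification for words in `ℕ` whose letters are bounded by their positions, with
distinct consecutive letters. -/
theorem star_word_eight_classification :
    ∀ p₀ ∈ List.range' 1 1, ∀ p₁ ∈ List.range' 1 2, p₀ ≠ p₁ →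
    ∀ p₂ ∈ List.range' 1 3, p₁ ≠ p₂ → ∀ p₃ ∈ List.range' 1 4, p₂ ≠ p₃ →
    ∀ p₄ ∈ List.range' 1 5, p₃ ≠ p₄ → ∀ p₅ ∈ List.range' 1 6, p₄ ≠ p₅ →
    ∀ p₆ ∈ List.range' 1 7, p₅ ≠ p₆ → ∀ p₇ ∈ List.range' 1 8, p₆ ≠ p₇ ∧ p₇ ≠ p₀ →
    (∀ y ∈ [0, p₀, p₁, p₂, p₃, p₄, p₅, p₆, p₇],
      Equiv.swap 0 p₀ (Equiv.swap 0 p₁ (Equiv.swap 0 p₂ (Equiv.swap 0 p₃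
        (Equiv.swap 0 p₄ (Equiv.swap 0 p₅ (Equiv.swap 0 p₆ (Equiv.swap 0 p₇ y))))))) = y) →
    ∃ s, IsStarPatternAt ![p₀, p₁, p₂, p₃, p₄, p₅, p₆, p₇] s := by
  decide +kernel

theorem stmt_17 {α : Type*} [DecidableEq α] (x : α) (a : Fin 8 → α)
    (ha : ∀ l : Fin 8, a l ≠ x)
    (h : (List.ofFn (fun l : Fin 8 => Equiv.swap x (a l))).prod = 1) :
    (∃ l : Fin 8, a l = a (l + 1)) ∨
      (∃ (s : Fin 8) (i j k : α),
        (a s = i ∧ a (s + 1) = j ∧ a (s + 2) = i ∧ a (s + 3) = k ∧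
          a (s + 4) = i ∧ a (s + 5) = j ∧ a (s + 6) = i ∧ a (s + 7) = k) ∨
        (a s = i ∧ a (s + 1) = j ∧ a (s + 2) = i ∧ a (s + 3) = k ∧
          a (s + 4) = j ∧ a (s + 5) = i ∧ a (s + 6) = j ∧ a (s + 7) = k)) := by
  refine or_iff_not_imp_left.mpr fun hadj => ?_
  push Not at hadj
  set W := x :: List.ofFn a with hW
  set g : α → ℕ := fun y => W.idxOf y with hg
  have hinj : Set.InjOn g {y | y ∈ W} := fun y hy z _ hyz => (List.idxOf_inj hy).mp hyz
  have hx : x ∈ W := List.mem_cons_self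
  have haW (l : Fin 8) : a l ∈ W := List.mem_cons_of_mem _ (List.mem_ofFn.mpr ⟨l, rfl⟩)
  have hgx : g x = 0 := List.idxOf_cons_self
  have hga (l m : Fin 8) : g (a l) = g (a m) ↔ a l = a m := hinj.eq_iff (haW l) (haW m)
  have hpos (l : Fin 8) : 0 < g (a l) := by
    rw [Nat.pos_iff_ne_zero, ← hgx, Ne, hinj.eq_iff (haW l) hx]
    exact ha l
  have hlt (l : Fin 8) : g (a l) < l + 2 := by
    have hl : (l : ℕ) + 1 < W.length := by simp only [hW, List.length_cons, List.length_ofFn]; omega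
    have hget : W[(l : ℕ) + 1] = a l := by simp only [hW, List.getElem_cons_succ, List.getElem_ofFn]
    by_contra! hlt
    have := List.not_of_lt_findIdx (show (l : ℕ) + 1 < W.findIdx (· == a l) from hlt)
    simp [hget] at this
  have hmem (l : Fin 8) : g (a l) ∈ List.range' 1 (l + 1) :=
    List.mem_range'_1.mpr ⟨hpos l, by have := hlt l; omega⟩
  have hne (l : Fin 8) : g (a l) ≠ g (a (l + 1)) := (hga _ _).not.mpr (hadj l)
  have hfix (y : α) (hy : y ∈ W) :
      ((List.ofFn a).map fun b => Equiv.swap 0 (g b)).prod (g y) = g y := by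
    have := (hinj.map_prod_swap_apply hx (List.ofFn a)
      (fun b hb => List.mem_cons_of_mem _ hb) hy).2
    rw [List.map_ofFn, Function.comp_def, h, hgx] at this
    exact this.symm
  obtain ⟨s, hs⟩ := star_word_eight_classification
    _ (hmem 0) _ (hmem 1) (hne 0) _ (hmem 2) (hne 1) _ (hmem 3) (hne 2) _ (hmem 4) (hne 3)
    _ (hmem 5) (hne 4) _ (hmem 6) (hne 5) _ (hmem 7) ⟨hne 6, hne 7⟩ (by
      intro z hz
      have hz' : z ∈ W.map g := by simpa [hW, hgx] using hz
      obtain ⟨y, hy, rfl⟩ := List.mem_map.mp hz'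
      simpa using hfix y hy)
  have hp : ![g (a 0), g (a 1), g (a 2), g (a 3), g (a 4), g (a 5), g (a 6), g (a 7)] =
      fun l => g (a l) := by
    ext l
    fin_cases l <;> rfl
  simp only [IsStarPatternAt, hp, hga] at hs
  obtain ⟨h2, h7, ⟨h4, h5, h6⟩ | ⟨h4, h5, h6⟩⟩ := hs
  · exact ⟨s, a s, a (s + 1), a (s + 3), Or.inl ⟨rfl, rfl, h2, rfl, h4, h5, h6, h7⟩⟩
  · exact ⟨s, a s, a (s + 1), a (s + 3), Or.inr ⟨rfl, rfl, h2, rfl, h4, h5, h6, h7⟩⟩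
end
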